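/- arXiv:1307.6110 — 3 statements merged into one kernel-verified Lean document; each statement's English description precedes it below -/
import Mathlib

section
/- (Proposition 4.2.) Let λ > 0, θ > 0, β_k ≥ 0 and α_k ≥ 0 for all k, and suppose A₁ ⪯ 0 and B₁ ⪯ 0. Let Ψ = {k : β_k = 0} and Ψ̄ = {k : β_k > 0}. Assume that the only vector x ∈ ℂ^M satisfying simultaneously xᴴ(Σ_{k∈Ψ} α_k ζ G_k − θ I) x = 0, hᴴ x = 0, and g_kᴴ x = 0 for every k ∈ Ψ̄, is x = 0. Then D₁ is negative definite (hence rank(D₁) = M); consequently rank(A₁) ≥ M − 1, and every positive semidefinite M×M matrix S satisfying A₁ S = 0 has rank(S) ≤ 1. -/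
open Matrix Finset
open scoped ComplexOrder

theorem star_dotProduct_vecMulVec_mulVec {n : Type*} [Fintype n] (v x : n → ℂ) :
    star x ⬝ᵥ (vecMulVec v (star v) *ᵥ x) = ((Complex.normSq (star v ⬝ᵥ x) : ℝ) : ℂ) := by
  rw [vecMulVec_mulVec, dotProduct_smul, Complex.normSq_eq_conj_mul_self]
  simp [Matrix.star_dotProduct x v]

theorem matrix_rank_add_le {m n R : Type*} [Fintype m] [Fintype n] [Field R]
    (A B : Matrix m n R) : (A + B).rank ≤ A.rank + B.rank := by
  have hsub : LinearMap.range (A + B).mulVecLin ≤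
      LinearMap.range A.mulVecLin ⊔ LinearMap.range B.mulVecLin := by
    rw [mulVecLin_add]
    exact LinearMap.range_add_le _ _
  exact (Submodule.finrank_mono hsub).trans (Submodule.finrank_add_le_finrank_add_finrank _ _)

theorem star_dotProduct_sum_smul_vecMulVec_mulVec {n ι : Type*} [Fintype n] (s : Finset ι)
    (c : ι → ℝ) (g : ι → n → ℂ) (x : n → ℂ) :
    star x ⬝ᵥ ((∑ k ∈ s, (c k : ℂ) • vecMulVec (g k) (star (g k))) *ᵥ x) =
      ((∑ k ∈ s, c k * Complex.normSq (star (g k) ⬝ᵥ x) : ℝ) : ℂ) := by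
  rw [Matrix.sum_mulVec, dotProduct_sum]
  push_cast
  refine Finset.sum_congr rfl fun k _ => ?_
  rw [smul_mulVec, dotProduct_smul, star_dotProduct_vecMulVec_mulVec, smul_eq_mul]

/-- Proposition 4.2: under the dual conditions, if the only x
satisfying xᴴ(Σ_{k∈Ψ} α_k ζ G_k − θ I)x = 0, hᴴx = 0 and g_kᴴx = 0 for all
k ∈ Ψ̄ is x = 0, then D₁ ≺ 0 (so rank(D₁) = M), rank(A₁) ≥ M − 1, and every
PSD S with A₁ S = 0 has rank(S) ≤ 1. -/
theorem stmt_7 (M K : ℕ) (hM : 1 ≤ M) (hK : 1 ≤ K)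
    (h : Fin M → ℂ) (g : Fin K → Fin M → ℂ)
    (γe ζ : ℝ) (hγe : 0 < γe) (hζ0 : 0 < ζ) (hζ1 : ζ ≤ 1)
    (lam θ : ℝ) (β α : Fin K → ℝ)
    (hlam : 0 < lam) (hθ : 0 < θ) (hβ : ∀ k, 0 ≤ β k) (hα : ∀ k, 0 ≤ α k)
    (A1 B1 D1 : Matrix (Fin M) (Fin M) ℂ)
    (hA1 : A1 = vecMulVec h (star h)
      - ∑ k, (β k : ℂ) • vecMulVec (g k) (star (g k))
      + ∑ k, ((α k * ζ : ℝ) : ℂ) • vecMulVec (g k) (star (g k))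
      - (θ : ℂ) • (1 : Matrix (Fin M) (Fin M) ℂ))
    (hB1 : B1 = -((lam : ℂ) • vecMulVec h (star h))
      + ∑ k, ((β k * γe : ℝ) : ℂ) • vecMulVec (g k) (star (g k))
      + ∑ k, ((α k * ζ : ℝ) : ℂ) • vecMulVec (g k) (star (g k))
      - (θ : ℂ) • (1 : Matrix (Fin M) (Fin M) ℂ))
    (hD1 : D1 = -((lam : ℂ) • vecMulVec h (star h))
      - ∑ k, (β k : ℂ) • vecMulVec (g k) (star (g k))
      + ∑ k, ((α k * ζ : ℝ) : ℂ) • vecMulVec (g k) (star (g k))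
      - (θ : ℂ) • (1 : Matrix (Fin M) (Fin M) ℂ))
    (hA1nsd : (-A1).PosSemidef) (hB1nsd : (-B1).PosSemidef)
    (hcond : ∀ x : Fin M → ℂ,
      star x ⬝ᵥ ((∑ k ∈ Finset.univ.filter (fun k => β k = 0),
          ((α k * ζ : ℝ) : ℂ) • vecMulVec (g k) (star (g k)))
        - (θ : ℂ) • (1 : Matrix (Fin M) (Fin M) ℂ)).mulVec x = 0 →
      star h ⬝ᵥ x = 0 →
      (∀ k, 0 < β k → star (g k) ⬝ᵥ x = 0) →
      x = 0) :
    (-D1).PosDef ∧ D1.rank = M ∧ M - 1 ≤ A1.rank ∧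
    ∀ S : Matrix (Fin M) (Fin M) ℂ, S.PosSemidef → A1 * S = 0 → S.rank ≤ 1 := by
  have hDA : -D1 = -A1 + ((1 + lam : ℝ) : ℂ) • vecMulVec h (star h) := by
    rw [hD1, hA1]; push_cast; module
  have hAD : A1 = D1 + vecMulVec (((1 + lam : ℝ) : ℂ) • h) (star h) := by
    rw [hD1, hA1, smul_vecMulVec]; push_cast; module
  have hDB : -D1 = -B1 + ∑ k, (((1 + γe) * β k : ℝ) : ℂ) • vecMulVec (g k) (star (g k)) := by
    have hsum : ∑ k, (((1 + γe) * β k : ℝ) : ℂ) • vecMulVec (g k) (star (g k)) =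
        ∑ k, (β k : ℂ) • vecMulVec (g k) (star (g k)) +
          ∑ k, ((β k * γe : ℝ) : ℂ) • vecMulVec (g k) (star (g k)) := by
      rw [← Finset.sum_add_distrib]
      refine Finset.sum_congr rfl fun k _ => ?_
      push_cast; module
    rw [hsum, hD1, hB1]; module
  have hDpsd : (-D1).PosSemidef := by
    rw [hDA]
    refine hA1nsd.add ((posSemidef_vecMulVec_self_star h).smul ?_)
    exact_mod_cast (by linarith : (0 : ℝ) ≤ 1 + lam)
  have hDpd : (-D1).PosDef := by
    refine .of_dotProduct_mulVec_pos hDpsd.1 fun x hx => ?_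
    refine lt_of_le_of_ne (hDpsd.dotProduct_mulVec_nonneg x) fun hzero => hx ?_
    have hB := hB1nsd.dotProduct_mulVec_nonneg x
    have hA := hA1nsd.dotProduct_mulVec_nonneg x
    have hhx : star h ⬝ᵥ x = 0 := by
      have e := hzero
      rw [hDA, add_mulVec, dotProduct_add, smul_mulVec, dotProduct_smul,
        star_dotProduct_vecMulVec_mulVec, smul_eq_mul, ← Complex.ofReal_mul] at e
      have e' := congrArg Complex.re e
      have hA' := (Complex.le_def.1 hA).1
      simp only [Complex.zero_re, Complex.add_re, Complex.ofReal_re] at e' hA'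
      refine Complex.normSq_eq_zero.1 ?_
      nlinarith [Complex.normSq_nonneg (star h ⬝ᵥ x)]
    have hgx : ∀ k, 0 < β k → star (g k) ⬝ᵥ x = 0 := by
      have e := hzero
      rw [hDB, add_mulVec, dotProduct_add, star_dotProduct_sum_smul_vecMulVec_mulVec] at e
      have e' := congrArg Complex.re e
      have hB' := (Complex.le_def.1 hB).1
      simp only [Complex.zero_re, Complex.add_re, Complex.ofReal_re] at e' hB'
      have hnn : ∀ k ∈ Finset.univ,
          0 ≤ (1 + γe) * β k * Complex.normSq (star (g k) ⬝ᵥ x) := fun k _ =>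
        mul_nonneg (mul_nonneg (by linarith) (hβ k)) (Complex.normSq_nonneg _)
      have hs := Finset.sum_nonneg hnn
      intro k hk
      have hk0 := (Finset.sum_eq_zero_iff_of_nonneg hnn).1 (by linarith) k (Finset.mem_univ k)
      have : 0 < (1 + γe) * β k := by positivity
      exact Complex.normSq_eq_zero.1 ((mul_eq_zero.1 hk0).resolve_left this.ne')
    refine hcond x ?_ hhx hgx
    have hDx : star x ⬝ᵥ (D1 *ᵥ x) = 0 := by
      rw [neg_mulVec, dotProduct_neg] at hzero
      exact neg_eq_zero.1 hzero.symm
    have hβx : ∑ k, β k * Complex.normSq (star (g k) ⬝ᵥ x) = 0 := by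
      refine Finset.sum_eq_zero fun k _ => ?_
      rcases (hβ k).eq_or_lt with hk | hk
      · rw [← hk, zero_mul]
      · rw [hgx k hk, map_zero, mul_zero]
    have hαx : ∑ k ∈ Finset.univ.filter (fun k => β k = 0),
          α k * ζ * Complex.normSq (star (g k) ⬝ᵥ x) =
        ∑ k, α k * ζ * Complex.normSq (star (g k) ⬝ᵥ x) := by
      refine Finset.sum_subset (Finset.filter_subset _ _) fun k _ hk => ?_
      have hk' : β k ≠ 0 := by simpa using hk
      rw [hgx k ((hβ k).lt_of_ne' hk'), map_zero, mul_zero]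
    rw [hD1, sub_mulVec, dotProduct_sub, add_mulVec, dotProduct_add, sub_mulVec, dotProduct_sub,
      neg_mulVec, dotProduct_neg, smul_mulVec, dotProduct_smul, star_dotProduct_vecMulVec_mulVec,
      star_dotProduct_sum_smul_vecMulVec_mulVec, star_dotProduct_sum_smul_vecMulVec_mulVec,
      hβx, hhx] at hDx
    rw [sub_mulVec, dotProduct_sub, star_dotProduct_sum_smul_vecMulVec_mulVec, hαx]
    simpa using hDx
  have hDrank : D1.rank = M := by
    have hu : IsUnit D1 := by simpa using hDpd.isUnit
    simpa using rank_of_isUnit D1 hu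
  have hArank : M - 1 ≤ A1.rank := by
    have hD : D1 = A1 + vecMulVec (-(((1 + lam : ℝ) : ℂ) • h)) (star h) := by
      rw [hAD, neg_vecMulVec]; abel
    have h1 := matrix_rank_add_le A1 (vecMulVec (-(((1 + lam : ℝ) : ℂ) • h)) (star h))
    have h2 := rank_vecMulVec_le (-(((1 + lam : ℝ) : ℂ) • h)) (star h)
    rw [← hD] at h1
    omega
  refine ⟨hDpd, hDrank, hArank, fun S _ hAS => ?_⟩
  have := rank_add_rank_le_card_of_mul_eq_zero hAS
  rw [Fintype.card_fin] at this
  omega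
end

section
/- (Corollary 4.1.) Let λ > 0, θ > 0, β_k ≥ 0 and α_k ≥ 0 for all k, and suppose A₁ ⪯ 0 and B₁ ⪯ 0. If β_k > 0 for every k = 1,…,K (i.e., the set Ψ = {k : β_k = 0} is empty), then D₁ is negative definite, and every positive semidefinite M×M matrix S satisfying A₁ S = 0 has rank(S) ≤ 1. -/
open Matrix Finset
open scoped ComplexOrder

theorem star_dotProduct_vecMulVec_star_mulVec {n : Type*} [Fintype n] (v x : n → ℂ) :
    star x ⬝ᵥ (vecMulVec v (star v) *ᵥ x) = (Complex.normSq (star v ⬝ᵥ x) : ℂ) := by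
  rw [vecMulVec_mulVec, Complex.normSq_eq_conj_mul_self]
  have hconj : (starRingEnd ℂ) (star v ⬝ᵥ x) = star x ⬝ᵥ v := by
    rw [starRingEnd_apply, star_dotProduct, star_star]
  rw [hconj]
  simp [dotProduct_smul, mul_comm]

theorem star_dotProduct_sum_smul_vecMulVec_star_mulVec {n ι : Type*} [Fintype n] [Fintype ι]
    (c : ι → ℝ) (g : ι → n → ℂ) (x : n → ℂ) :
    star x ⬝ᵥ ((∑ k, (c k : ℂ) • vecMulVec (g k) (star (g k))) *ᵥ x) =
      ((∑ k, c k * Complex.normSq (star (g k) ⬝ᵥ x) : ℝ) : ℂ) := by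
  simp only [sum_mulVec, dotProduct_sum, smul_mulVec, dotProduct_smul,
    star_dotProduct_vecMulVec_star_mulVec]
  push_cast
  rfl

theorem star_dotProduct_self_eq_sum_normSq {n : Type*} [Fintype n] (x : n → ℂ) :
    star x ⬝ᵥ x = ((∑ i, Complex.normSq (x i) : ℝ) : ℂ) := by
  push_cast
  simp [dotProduct, Complex.normSq_eq_conj_mul_self]

/-- Corollary 4.1: under the dual conditions, if β_k > 0 for every
k (i.e., Ψ = ∅), then D₁ is negative definite, and every PSD S with A₁ S = 0
has rank(S) ≤ 1. -/
theorem stmt_8 (M K : ℕ) (hM : 1 ≤ M) (hK : 1 ≤ K)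
    (h : Fin M → ℂ) (g : Fin K → Fin M → ℂ)
    (γe ζ : ℝ) (hγe : 0 < γe) (hζ0 : 0 < ζ) (hζ1 : ζ ≤ 1)
    (lam θ : ℝ) (β α : Fin K → ℝ)
    (hlam : 0 < lam) (hθ : 0 < θ) (hβpos : ∀ k, 0 < β k) (hα : ∀ k, 0 ≤ α k)
    (A1 B1 D1 : Matrix (Fin M) (Fin M) ℂ)
    (hA1 : A1 = vecMulVec h (star h)
      - ∑ k, (β k : ℂ) • vecMulVec (g k) (star (g k))
      + ∑ k, ((α k * ζ : ℝ) : ℂ) • vecMulVec (g k) (star (g k))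
      - (θ : ℂ) • (1 : Matrix (Fin M) (Fin M) ℂ))
    (hB1 : B1 = -((lam : ℂ) • vecMulVec h (star h))
      + ∑ k, ((β k * γe : ℝ) : ℂ) • vecMulVec (g k) (star (g k))
      + ∑ k, ((α k * ζ : ℝ) : ℂ) • vecMulVec (g k) (star (g k))
      - (θ : ℂ) • (1 : Matrix (Fin M) (Fin M) ℂ))
    (hD1 : D1 = -((lam : ℂ) • vecMulVec h (star h))
      - ∑ k, (β k : ℂ) • vecMulVec (g k) (star (g k))
      + ∑ k, ((α k * ζ : ℝ) : ℂ) • vecMulVec (g k) (star (g k))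
      - (θ : ℂ) • (1 : Matrix (Fin M) (Fin M) ℂ))
    (hA1nsd : (-A1).PosSemidef) (hB1nsd : (-B1).PosSemidef) :
    (-D1).PosDef ∧
    ∀ S : Matrix (Fin M) (Fin M) ℂ, S.PosSemidef → A1 * S = 0 → S.rank ≤ 1 := by
  have hBD : -D1 = -B1 + ∑ k, (((1 + γe) * β k : ℝ) : ℂ) • vecMulVec (g k) (star (g k)) := by
    rw [hB1, hD1]
    have hsum : ∑ k, (((1 + γe) * β k : ℝ) : ℂ) • vecMulVec (g k) (star (g k)) =
        ∑ k, (β k : ℂ) • vecMulVec (g k) (star (g k)) +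
        ∑ k, ((β k * γe : ℝ) : ℂ) • vecMulVec (g k) (star (g k)) := by
      rw [← Finset.sum_add_distrib]
      refine Finset.sum_congr rfl fun k _ => ?_
      rw [← add_smul]
      congr 1
      push_cast
      ring
    rw [hsum]
    abel
  have hpsd : (-D1).PosSemidef := by
    rw [hBD]
    refine hB1nsd.add (posSemidef_sum _ fun k _ => ?_)
    refine (posSemidef_vecMulVec_self_star (g k)).smul ?_
    have := hβpos k
    exact_mod_cast (by positivity : (0 : ℝ) ≤ (1 + γe) * β k)
  have hpd : (-D1).PosDef := by
    refine PosDef.of_dotProduct_mulVec_pos hpsd.isHermitian fun x hx => ?_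
    have hBx := hB1nsd.dotProduct_mulVec_nonneg x
    set q : Fin K → ℝ := fun k => Complex.normSq (star (g k) ⬝ᵥ x) with hq
    have hq0 : ∀ k, 0 ≤ q k := fun k => Complex.normSq_nonneg _
    have hn : 0 < ∑ i, Complex.normSq (x i) := by
      obtain ⟨i, hi⟩ := Function.ne_iff.1 hx
      exact Finset.sum_pos' (fun _ _ => Complex.normSq_nonneg _)
        ⟨i, Finset.mem_univ i, Complex.normSq_pos.2 hi⟩
    have hB : star x ⬝ᵥ (-B1 *ᵥ x) = ((lam * Complex.normSq (star h ⬝ᵥ x)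
        - ∑ k, β k * γe * q k - ∑ k, α k * ζ * q k
        + θ * ∑ i, Complex.normSq (x i) : ℝ) : ℂ) := by
      rw [hB1]
      simp only [neg_mulVec, sub_mulVec, add_mulVec, dotProduct_neg, dotProduct_sub,
        dotProduct_add, star_dotProduct_sum_smul_vecMulVec_star_mulVec, smul_mulVec,
        dotProduct_smul, one_mulVec, star_dotProduct_vecMulVec_star_mulVec,
        star_dotProduct_self_eq_sum_normSq, smul_eq_mul, hq]
      push_cast
      ring
    rw [hB] at hBx
    rw [hBD, add_mulVec, dotProduct_add, hB, star_dotProduct_sum_smul_vecMulVec_star_mulVec,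
      ← Complex.ofReal_add]
    have hBx' := Complex.zero_le_real.1 hBx
    refine Complex.zero_lt_real.2 ?_
    have hterm : ∀ k, 0 ≤ (1 + γe) * β k * q k := fun k =>
      mul_nonneg (mul_pos (by linarith) (hβpos k)).le (hq0 k)
    by_cases hall : ∀ k, q k = 0
    · have hh : 0 ≤ Complex.normSq (star h ⬝ᵥ x) := Complex.normSq_nonneg _
      have hall' : ∀ k, Complex.normSq (star (g k) ⬝ᵥ x) = 0 := hall
      simp only [hall, hall', mul_zero, Finset.sum_const_zero, sub_zero, add_zero]
      positivity
    · push Not at hall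
      obtain ⟨k, hk⟩ := hall
      refine add_pos_of_nonneg_of_pos hBx' (Finset.sum_pos' (fun k _ => hterm k)
        ⟨k, Finset.mem_univ k, ?_⟩)
      exact mul_pos (mul_pos (by linarith) (hβpos k)) (lt_of_le_of_ne (hq0 k) hk.symm)
  refine ⟨hpd, fun S _ hS => ?_⟩
  have hAD : A1 = D1 + vecMulVec ((1 + lam : ℂ) • h) (star h) := by
    rw [hA1, hD1, smul_vecMulVec, add_smul, one_smul]
    abel
  have hDS : -D1 * S = vecMulVec ((1 + lam : ℂ) • h) (star h) * S := by
    rw [hAD, add_mul] at hS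
    rw [neg_mul, neg_eq_iff_add_eq_zero, hS]
  calc S.rank = (-D1 * S).rank :=
        (rank_mul_eq_right_of_isUnit_det _ _ ((isUnit_iff_isUnit_det _).1 hpd.isUnit)).symm
    _ ≤ (vecMulVec ((1 + lam : ℂ) • h) (star h)).rank := hDS ▸ rank_mul_le_left _ _
    _ ≤ 1 := rank_vecMulVec_le _ _
end

section
/- (Optimality transfer from (P2.1-SDR-New) to (P2.1-SDR).) Suppose (S*, Q*) is an optimal solution to problem (P2.1-SDR) with optimal value E*. Suppose (S̄, Q̄) maximizes Tr(H S)/(Tr(H Q) + σ₀²) over all PSD pairs (S, Q) satisfying Tr(G_k S) ≤ γ_e (Tr(G_k Q) + σ_k²) for all k, Tr(S) + Tr(Q) ≤ P̄, and Σ_{k=1}^K μ_k ζ (Tr(G_k S) + Tr(G_k Q)) ≥ E* (problem (P2.1-SDR-New)). Then Tr(H S̄) ≥ γ₀ (Tr(H Q̄) + σ₀²), the weighted sum-energy objective of (P2.1-SDR) at (S̄, Q̄) equals E*, and hence (S̄, Q̄) is also an optimal solution to (P2.1-SDR). -/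
open Matrix Finset
open scoped ComplexOrder

theorem Matrix.PosSemidef.re_trace_vecMulVec_mul_nonneg {n : Type*} [Fintype n]
    {A : Matrix n n ℂ} (hA : A.PosSemidef) (v : n → ℂ) :
    0 ≤ (vecMulVec v (star v) * A).trace.re := by
  rw [vecMulVec_mul, trace_vecMulVec, dotProduct_comm, ← dotProduct_mulVec]
  exact (Complex.le_def.mp (hA.dotProduct_mulVec_nonneg v)).1

/-- optimality transfer from (P2.1-SDR-New) to (P2.1-SDR): if
(S*, Q*) is optimal for (P2.1-SDR) with optimal value E*, and (S̄, Q̄) is optimal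
for (P2.1-SDR-New), then Tr(H S̄) ≥ γ₀(Tr(H Q̄) + σ₀²), the weighted sum-energy
at (S̄, Q̄) equals E*, and (S̄, Q̄) is also optimal for (P2.1-SDR). -/
theorem stmt_14 (M K : ℕ) (hM : 1 ≤ M) (hK : 1 ≤ K)
    (h : Fin M → ℂ) (g : Fin K → Fin M → ℂ)
    (σ0 : ℝ) (hσ0 : 0 < σ0) (σ : Fin K → ℝ) (hσ : ∀ k, 0 < σ k)
    (ζ : ℝ) (hζ0 : 0 < ζ) (hζ1 : ζ ≤ 1) (P : ℝ) (hP : 0 < P)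
    (μ : Fin K → ℝ) (hμ : ∀ k, 0 ≤ μ k)
    (γ0 : ℝ) (hγ0 : 0 < γ0) (rbar0 : ℝ) (hrbar0 : 0 < rbar0)
    (γe : ℝ) (hγedef : γe = (1 + γ0) / (2 : ℝ) ^ rbar0 - 1) (hγe : 0 < γe)
    (H : Matrix (Fin M) (Fin M) ℂ) (hH : H = vecMulVec h (star h))
    (G : Fin K → Matrix (Fin M) (Fin M) ℂ)
    (hG : ∀ k, G k = vecMulVec (g k) (star (g k)))
    (Sstar Qstar : Matrix (Fin M) (Fin M) ℂ) (Estar : ℝ)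
    -- (S*, Q*) is feasible for (P2.1-SDR):
    (hSstar : Sstar.PosSemidef) (hQstar : Qstar.PosSemidef)
    (hstar1 : (H * Sstar).trace.re ≥ γ0 * ((H * Qstar).trace.re + σ0))
    (hstar2 : ∀ k, ((G k) * Sstar).trace.re ≤ γe * (((G k) * Qstar).trace.re + σ k))
    (hstar3 : Sstar.trace.re + Qstar.trace.re ≤ P)
    -- with objective value E*:
    (hEstar : Estar = ∑ k, μ k * ζ * (((G k) * Sstar).trace.re + ((G k) * Qstar).trace.re))
    -- and it is optimal for (P2.1-SDR):
    (hoptstar : ∀ S Q : Matrix (Fin M) (Fin M) ℂ, S.PosSemidef → Q.PosSemidef →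
      (H * S).trace.re ≥ γ0 * ((H * Q).trace.re + σ0) →
      (∀ k, ((G k) * S).trace.re ≤ γe * (((G k) * Q).trace.re + σ k)) →
      S.trace.re + Q.trace.re ≤ P →
      ∑ k, μ k * ζ * (((G k) * S).trace.re + ((G k) * Q).trace.re) ≤ Estar)
    (Sbar Qbar : Matrix (Fin M) (Fin M) ℂ)
    -- (S̄, Q̄) is feasible for (P2.1-SDR-New):
    (hSbar : Sbar.PosSemidef) (hQbar : Qbar.PosSemidef)
    (hbar2 : ∀ k, ((G k) * Sbar).trace.re ≤ γe * (((G k) * Qbar).trace.re + σ k))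
    (hbar3 : Sbar.trace.re + Qbar.trace.re ≤ P)
    (hbar4 : ∑ k, μ k * ζ * (((G k) * Sbar).trace.re + ((G k) * Qbar).trace.re) ≥ Estar)
    -- and it is optimal for (P2.1-SDR-New):
    (hoptbar : ∀ S Q : Matrix (Fin M) (Fin M) ℂ, S.PosSemidef → Q.PosSemidef →
      (∀ k, ((G k) * S).trace.re ≤ γe * (((G k) * Q).trace.re + σ k)) →
      S.trace.re + Q.trace.re ≤ P →
      ∑ k, μ k * ζ * (((G k) * S).trace.re + ((G k) * Q).trace.re) ≥ Estar →
      (H * S).trace.re / ((H * Q).trace.re + σ0) ≤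
        (H * Sbar).trace.re / ((H * Qbar).trace.re + σ0)) :
    (H * Sbar).trace.re ≥ γ0 * ((H * Qbar).trace.re + σ0) ∧
    ∑ k, μ k * ζ * (((G k) * Sbar).trace.re + ((G k) * Qbar).trace.re) = Estar ∧
    (∀ S Q : Matrix (Fin M) (Fin M) ℂ, S.PosSemidef → Q.PosSemidef →
      (H * S).trace.re ≥ γ0 * ((H * Q).trace.re + σ0) →
      (∀ k, ((G k) * S).trace.re ≤ γe * (((G k) * Q).trace.re + σ k)) →
      S.trace.re + Q.trace.re ≤ P →
      ∑ k, μ k * ζ * (((G k) * S).trace.re + ((G k) * Q).trace.re) ≤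
        ∑ k, μ k * ζ * (((G k) * Sbar).trace.re + ((G k) * Qbar).trace.re)) := by
  subst hH
  have hstar_pos : 0 < (vecMulVec h (star h) * Qstar).trace.re + σ0 :=
    add_pos_of_nonneg_of_pos (hQstar.re_trace_vecMulVec_mul_nonneg h) hσ0
  have hbar_pos : 0 < (vecMulVec h (star h) * Qbar).trace.re + σ0 :=
    add_pos_of_nonneg_of_pos (hQbar.re_trace_vecMulVec_mul_nonneg h) hσ0
  have hratio := hoptbar Sstar Qstar hSstar hQstar hstar2 hstar3 hEstar.le
  have hsinr : (vecMulVec h (star h) * Sbar).trace.re ≥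
      γ0 * ((vecMulVec h (star h) * Qbar).trace.re + σ0) :=
    (le_div_iff₀ hbar_pos).mp (((le_div_iff₀ hstar_pos).mpr hstar1).trans hratio)
  exact ⟨hsinr, le_antisymm (hoptstar Sbar Qbar hSbar hQbar hsinr hbar2 hbar3) hbar4,
    fun S Q hS hQ h1 h2 h3 => (hoptstar S Q hS hQ h1 h2 h3).trans hbar4⟩
end
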